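/- Let p ≥ 5 and R > 0. Then there is no function u that is twice continuously differentiable on closure(B_R), positive on B_R, vanishes on ∂B_R, and satisfies the Lane–Emden equation Δu + 4π u^p = 0 on B_R. -/

import Mathlib

open MeasureTheory Real

/-- The Laplacian on `ℝ³`: sum of the pure second directional derivatives along the
standard orthonormal basis. -/
noncomputable def lap (u : EuclideanSpace ℝ (Fin 3) → ℝ) (x : EuclideanSpace ℝ (Fin 3)) : ℝ :=
  ∑ i : Fin 3, iteratedFDeriv ℝ 2 u x ![EuclideanSpace.single i 1, EuclideanSpace.single i 1]

local notation "E₃" => EuclideanSpace ℝ (Fin 3)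

local notation "𝐞" i:max => (EuclideanSpace.single i (1 : ℝ) : EuclideanSpace ℝ (Fin 3))

/-- The integral of a directional derivative of a compactly supported `C¹` function vanishes. -/
lemma integral_fderiv_apply_eq_zero {f : E₃ → ℝ} (hf : ContDiff ℝ 1 f)
    (hc : HasCompactSupport f) (v : E₃) :
    Integrable (fun x => fderiv ℝ f x v) ∧ ∫ x, fderiv ℝ f x v = 0 := by
  have hi : Integrable (fun x => fderiv ℝ f x v) :=
    ((hf.continuous_fderiv one_ne_zero).clm_apply
      continuous_const).integrable_of_hasCompactSupport (hc.fderiv_apply ℝ v)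
  refine ⟨hi, ?_⟩
  have h := integral_mul_fderiv_eq_neg_fderiv_mul_of_integrable (μ := volume) (f := f)
    (g := fun _ => (1 : ℝ)) (v := v) (by simpa using hi) (by simp)
    (by simpa using hf.continuous.integrable_of_hasCompactSupport hc)
    (fun x _ => (hf.differentiable one_ne_zero) x) (fun x _ => by fun_prop)
  simpa using h

/-- A radially nonincreasing `C¹` cutoff, equal to `1` on the ball of radius `a` and supported in
the closed ball of radius `b`. -/
lemma exists_radial_cutoff {a b : ℝ} (ha : 0 < a) (hab : a < b) :
    ∃ (φ : E₃ → ℝ) (c : E₃ → ℝ), ContDiff ℝ 1 φ ∧ (∀ x, 0 ≤ φ x) ∧ (∀ x, φ x ≤ 1) ∧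
      (∀ x, ‖x‖ ≤ a → φ x = 1) ∧ tsupport φ ⊆ Metric.closedBall 0 b ∧
      (∀ x, 0 ≤ c x) ∧ (∀ x, ‖x‖ < a → c x = 0) ∧
      ∀ x, HasFDerivAt φ (-c x • innerSL ℝ x) x := by
  have hd : 0 < b ^ 2 - a ^ 2 := by nlinarith
  let s : E₃ → ℝ := fun x => (b ^ 2 - ‖x‖ ^ 2) / (b ^ 2 - a ^ 2)
  have hs : ∀ x, HasFDerivAt s (-(2 / (b ^ 2 - a ^ 2)) • innerSL ℝ x) x := by
    intro x
    have h := ((hasStrictFDerivAt_norm_sq x).hasFDerivAt.const_sub (b ^ 2)).mul_const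
      (b ^ 2 - a ^ 2)⁻¹
    refine h.congr_fderiv ?_
    ext v
    simp
    ring
  have hT : ContDiff ℝ 1 smoothTransition := smoothTransition.contDiff
  refine ⟨fun x => smoothTransition (s x),
    fun x => deriv smoothTransition (s x) * (2 / (b ^ 2 - a ^ 2)), ?_,
    fun x => smoothTransition.nonneg _, fun x => smoothTransition.le_one _, ?_, ?_, ?_, ?_, ?_⟩
  · exact hT.comp ((contDiff_const.sub (contDiff_norm_sq ℝ)).div_const _)
  · intro x hx
    refine smoothTransition.one_of_one_le ?_
    rw [one_le_div hd]
    nlinarith [norm_nonneg x]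
  · refine closure_minimal (fun x hx => ?_) Metric.isClosed_closedBall
    rw [mem_closedBall_zero_iff]
    by_contra! hxb
    refine hx (smoothTransition.zero_of_nonpos (div_nonpos_of_nonpos_of_nonneg ?_ hd.le))
    nlinarith
  · intro x
    exact mul_nonneg (smoothTransition.monotone.deriv_nonneg) (by positivity)
  · intro x hx
    have h1 : 1 < s x := by
      rw [one_lt_div hd]
      nlinarith [norm_nonneg x]
    have : smoothTransition =ᶠ[nhds (s x)] fun _ => 1 := by
      filter_upwards [lt_mem_nhds h1] with t ht
      exact smoothTransition.one_of_one_le ht.le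
    simp [this.deriv_eq]
  · intro x
    have h := ((hT.differentiable one_ne_zero) (s x)).hasDerivAt.comp_hasFDerivAt x (hs x)
    refine h.congr_fderiv ?_
    rw [smul_smul]
    congr 1
    ring

/-- The Pohozaev vector field of `u`, with `G` standing for the derivative of `u`, perturbed by
`ε ∇u + (ε² / R²) x`. -/
noncomputable def pohozaevField (p ε R : ℝ) (u : E₃ → ℝ) (G : E₃ → E₃ →L[ℝ] ℝ) (i : Fin 3)
    (x : E₃) : ℝ :=
  (∑ j, x j * G x (𝐞 j)) * G x (𝐞 i) - (∑ j, G x (𝐞 j) * G x (𝐞 j)) / 2 * x i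
    + u x / 2 * G x (𝐞 i) + 4 * π / (p + 1) * u x ^ (p + 1) * x i
    + ε * G x (𝐞 i) + ε ^ 2 / R ^ 2 * x i

/-- The pointwise Pohozaev identity, in localized form. -/
lemma sum_fderiv_mul_pohozaevField {p ε R : ℝ} (hp : 0 < p + 1) {u : E₃ → ℝ}
    {G : E₃ → E₃ →L[ℝ] ℝ} {D : E₃ →L[ℝ] E₃ →L[ℝ] ℝ} {φ : E₃ → ℝ} {c : ℝ} {x : E₃}
    (hu : HasFDerivAt u (G x) x) (hG : HasFDerivAt G D x) (hD : ∀ v w, D v w = D w v)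
    (hpos : 0 < u x) (hlap : ∑ i, D (𝐞 i) (𝐞 i) = -(4 * π * u x ^ p))
    (hφ : HasFDerivAt φ (-c • innerSL ℝ x) x) :
    ∑ i, fderiv ℝ (fun y => φ y * pohozaevField p ε R u G i y) x (𝐞 i) =
      φ x * (4 * π * u x ^ (p + 1) * ((5 - p) / (2 * (p + 1))) - 4 * π * ε * u x ^ p
        + 3 * ε ^ 2 / R ^ 2) - c * ∑ i, x i * pohozaevField p ε R u G i x := by
  have hX : ∀ j : Fin 3, HasFDerivAt (fun y : E₃ => y j) (EuclideanSpace.proj j : E₃ →L[ℝ] ℝ) x :=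
    fun j => (EuclideanSpace.proj j : E₃ →L[ℝ] ℝ).hasFDerivAt
  have hg : ∀ j : Fin 3, HasFDerivAt (fun y : E₃ => G y (𝐞 j)) (D.flip (𝐞 j)) x := by
    intro j
    have h := hG.clm_apply (hasFDerivAt_const (𝐞 j) x)
    refine h.congr_fderiv ?_
    ext v
    simp
  have hr : HasFDerivAt (fun y => u y ^ (p + 1)) (((p + 1) * u x ^ p) • G x) x := by
    have h := hu.rpow_const (p := p + 1) (Or.inl hpos.ne')
    simpa using h
  have hW := fun i =>
    hφ.mul ((((((((HasFDerivAt.fun_sum fun j (_ : j ∈ Finset.univ) => (hX j).mul (hg j)).mul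
      (hg i)).sub (((HasFDerivAt.fun_sum fun j (_ : j ∈ Finset.univ) =>
        (hg j).mul (hg j)).mul_const (2⁻¹)).mul (hX i))).add ((hu.mul_const (2⁻¹)).mul (hg i))).add
      ((hr.const_mul (4 * π / (p + 1))).mul (hX i))).add ((hg i).const_mul ε)).add
      ((hX i).const_mul (ε ^ 2 / R ^ 2))))
  have hpow : u x ^ (p + 1) = u x ^ p * u x := by rw [rpow_add hpos, rpow_one]
  have hF : ∀ i, fderiv ℝ (fun y => φ y * pohozaevField p ε R u G i y) x = _ := fun i =>
    ((hW i).congr_of_eventuallyEq (.of_forall fun y => by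
      simp [pohozaevField, div_eq_mul_inv])).fderiv
  simp only [hF]
  simp [Fin.sum_univ_three, pohozaevField, EuclideanSpace.inner_single_right] at hlap ⊢
  rw [hD (𝐞 1) (𝐞 0), hD (𝐞 2) (𝐞 0), hD (𝐞 2) (𝐞 1), hpow,
    show D (𝐞 2) (𝐞 2) = -(4 * π * u x ^ p) - D (𝐞 0) (𝐞 0) - D (𝐞 1) (𝐞 1) by linarith]
  field_simp
  ring

/-- At a boundary point of a ball, the derivative of a function vanishing on the sphere vanishes
in tangential directions. -/
lemma fderivWithin_tangent_eq_zero {R : ℝ} {u : E₃ → ℝ} {L : E₃ →L[ℝ] ℝ} {x v : E₃}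
    (hu : HasFDerivWithinAt u L (Metric.closedBall 0 R) x)
    (h0 : ∀ y ∈ Metric.sphere (0 : E₃) R, u y = 0) (hx : ‖x‖ = R) (hR : 0 < R)
    (hv : inner ℝ x v = 0) : L v = 0 := by
  rcases eq_or_ne v 0 with rfl | hv0
  · simp
  have hn : 0 < ‖v‖ := norm_pos_iff.2 hv0
  set w : E₃ := (R / ‖v‖) • v with hw
  have hwn : ‖w‖ = R := by
    rw [hw, norm_smul, norm_of_nonneg (by positivity)]
    field_simp
  have hxw : inner ℝ x w = 0 := by rw [hw, inner_smul_right, hv, mul_zero]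
  let γ : ℝ → E₃ := fun t => cos t • x + sin t • w
  have hγ : HasDerivAt γ w 0 := by
    have h := ((hasDerivAt_cos 0).smul_const x).fun_add ((hasDerivAt_sin 0).smul_const w)
    exact h.congr_deriv (by simp)
  have hmem : ∀ t, γ t ∈ Metric.sphere (0 : E₃) R := by
    intro t
    rw [mem_sphere_zero_iff_norm, ← sq_eq_sq₀ (norm_nonneg _) hR.le, norm_add_sq_real,
      norm_smul, norm_smul, inner_smul_left, inner_smul_right, hxw, hwn, hx, mul_pow, mul_pow,
      norm_eq_abs, norm_eq_abs, sq_abs, sq_abs]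
    nlinarith [sin_sq_add_cos_sq t]
  have h1 : HasDerivAt (u ∘ γ) (L w) 0 :=
    hu.comp_hasDerivAt_of_eq 0 hγ (.of_forall fun t => Metric.sphere_subset_closedBall (hmem t))
      (by simp [γ])
  have h2 : u ∘ γ = fun _ => 0 := funext fun t => h0 _ (hmem t)
  have h3 : L w = 0 := h1.unique (h2 ▸ hasDerivAt_const _ _)
  rw [hw, map_smul, smul_eq_mul] at h3
  exact (mul_eq_zero.1 h3).resolve_left (by positivity)

/-- If `L` annihilates the orthogonal complement of `x`, then equality holds in the
Cauchy-Schwarz inequality. -/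
lemma sum_mul_apply_sq_eq {L : E₃ →L[ℝ] ℝ} {x : E₃}
    (h : ∀ v, inner ℝ x v = 0 → L v = 0) :
    (∑ j, x j * L (𝐞 j)) ^ 2 = ‖x‖ ^ 2 * ∑ j, L (𝐞 j) * L (𝐞 j) := by
  have hL : ∀ v : E₃, L v = ∑ j, v j * L (𝐞 j) := by
    intro v
    conv_lhs => rw [← (EuclideanSpace.basisFun (Fin 3) ℝ).sum_repr v]
    simp
  have hin : ∀ v : E₃, inner ℝ x v = ∑ j, x j * v j := by
    intro v
    simp [PiLp.inner_apply, mul_comm]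
  let g : E₃ := WithLp.toLp 2 fun j => L (𝐞 j)
  have h1 := h (‖x‖ ^ 2 • g - (inner ℝ x g) • x) (by
    rw [inner_sub_right, inner_smul_right, inner_smul_right, real_inner_self_eq_norm_sq]
    ring)
  rw [map_sub, map_smul, map_smul, hL g, hL x, hin g] at h1
  simp only [g, smul_eq_mul] at h1
  linarith

/-- The perturbed Pohozaev field points outwards on the sphere. -/
lemma sum_mul_pohozaevField_pos {p ε R : ℝ} (hp : 0 < p + 1) (hε : 0 < ε) (hR : 0 < R)
    {u : E₃ → ℝ} {G : E₃ → E₃ →L[ℝ] ℝ} {x : E₃} (hx : ‖x‖ = R) (hu : u x = 0)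
    (hG : ∀ v, inner ℝ x v = 0 → G x v = 0) :
    0 < ∑ i, x i * pohozaevField p ε R u G i x := by
  have h := sum_mul_apply_sq_eq hG
  have hn : ‖x‖ ^ 2 = ∑ j, x j * x j := by
    rw [EuclideanSpace.norm_sq_eq]
    exact Finset.sum_congr rfl fun j _ => by rw [norm_eq_abs, sq_abs, sq]
  have key : ∑ i, x i * pohozaevField p ε R u G i x =
      (∑ j, x j * G x (𝐞 j)) ^ 2 - ‖x‖ ^ 2 * (∑ j, G x (𝐞 j) * G x (𝐞 j)) / 2
        + ε * (∑ j, x j * G x (𝐞 j)) + ε ^ 2 / R ^ 2 * ‖x‖ ^ 2 := by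
    rw [hn]
    simp only [pohozaevField, hu, zero_rpow hp.ne', Fin.sum_univ_three]
    ring
  rw [key, ← h, hx, div_mul_cancel₀ _ (by positivity)]
  nlinarith [sq_nonneg (∑ j, x j * G x (𝐞 j) + ε), pow_pos hε 2]

/-- Positivity on the sphere persists in a neighbourhood of the sphere inside the ball. -/
lemma exists_radius_forall_pos {R : ℝ} (hR : 0 < R) {f : E₃ → ℝ}
    (hf : ContinuousOn f (Metric.closedBall 0 R)) (hpos : ∀ x, ‖x‖ = R → 0 < f x) :
    ∃ r, R / 2 < r ∧ r < R ∧ ∀ x, r ≤ ‖x‖ → ‖x‖ ≤ R → 0 < f x := by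
  have hK : IsCompact (Metric.closedBall (0 : E₃) R ∩ f ⁻¹' Set.Iic 0) :=
    (isCompact_closedBall (0 : E₃) R).of_isClosed_subset
      (hf.preimage_isClosed_of_isClosed Metric.isClosed_closedBall isClosed_Iic)
      Set.inter_subset_left
  obtain ⟨M, hMR, hM⟩ : ∃ M < R, ∀ x, ‖x‖ ≤ R → f x ≤ 0 → ‖x‖ ≤ M := by
    rcases Set.eq_empty_or_nonempty (Metric.closedBall (0 : E₃) R ∩ f ⁻¹' Set.Iic 0) with he | hne
    · refine ⟨0, hR, fun x hx hfx => ?_⟩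
      have : x ∈ Metric.closedBall (0 : E₃) R ∩ f ⁻¹' Set.Iic 0 :=
        ⟨mem_closedBall_zero_iff.2 hx, hfx⟩
      simp [he] at this
    · obtain ⟨y, ⟨hyR, hy⟩, hmax⟩ := hK.exists_isMaxOn hne continuous_norm.continuousOn
      refine ⟨‖y‖, lt_of_le_of_ne (mem_closedBall_zero_iff.1 hyR) fun h => ?_,
        fun x hx hfx => hmax ⟨mem_closedBall_zero_iff.2 hx, hfx⟩⟩
      exact (hpos y h).not_ge hy
  refine ⟨(max M (R / 2) + R) / 2, ?_, ?_, fun x hx hxR => ?_⟩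
  · linarith [le_max_right M (R / 2)]
  · linarith [max_lt hMR (half_lt_self hR)]
  · by_contra! hfx
    have := hM x hxR hfx
    linarith [le_max_left M (R / 2), max_lt hMR (half_lt_self hR)]

lemma continuousOn_pohozaevField {p ε R : ℝ} (hp : 0 < p + 1) {u : E₃ → ℝ}
    {G : E₃ → E₃ →L[ℝ] ℝ} {s : Set E₃} (hu : ContinuousOn u s) (hG : ContinuousOn G s)
    (i : Fin 3) : ContinuousOn (pohozaevField p ε R u G i) s := by
  unfold pohozaevField
  fun_prop (disch := first | exact fun _ _ => Or.inr hp.le | exact hp.le)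

lemma contDiffAt_pohozaevField {p ε R : ℝ} {u : E₃ → ℝ} {G : E₃ → E₃ →L[ℝ] ℝ} {x : E₃}
    (hu : ContDiffAt ℝ 1 u x) (hG : ContDiffAt ℝ 1 G x) (hpos : 0 < u x) (i : Fin 3) :
    ContDiffAt ℝ 1 (pohozaevField p ε R u G i) x := by
  unfold pohozaevField
  have hr : ContDiffAt ℝ 1 (fun y => u y ^ (p + 1)) x := hu.rpow_const_of_ne hpos.ne'
  fun_prop (disch := exact hpos.ne')

/-- Pohozaev nonexistence: for `p ≥ 5` there is no positive Dirichlet solution of the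
Lane–Emden equation `Δu + 4π u^p = 0` on any finite ball. -/
theorem lane_emden_nonexistence (p : ℝ) (hp : 5 ≤ p) (R : ℝ) (hR : 0 < R) :
    ¬ ∃ u : EuclideanSpace ℝ (Fin 3) → ℝ,
        ContDiffOn ℝ 2 u (closure (Metric.ball (0 : EuclideanSpace ℝ (Fin 3)) R)) ∧
        (∀ x ∈ Metric.ball (0 : EuclideanSpace ℝ (Fin 3)) R, 0 < u x) ∧
        (∀ x ∈ Metric.sphere (0 : EuclideanSpace ℝ (Fin 3)) R, u x = 0) ∧
        (∀ x ∈ Metric.ball (0 : EuclideanSpace ℝ (Fin 3)) R,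
          lap u x + 4 * π * u x ^ p = 0) := by
  rintro ⟨u, hu, hpos, hbd, heq⟩
  rw [closure_ball _ hR.ne'] at hu
  have hp1 : 0 < p + 1 := by linarith
  have hud : UniqueDiffOn ℝ (Metric.closedBall (0 : E₃) R) :=
    uniqueDiffOn_convex (convex_closedBall _ _) (by
      rw [interior_closedBall _ hR.ne']
      exact Metric.nonempty_ball.2 hR)
  set G : E₃ → E₃ →L[ℝ] ℝ := fderivWithin ℝ u (Metric.closedBall 0 R)
  have hGc : ContinuousOn G (Metric.closedBall 0 R) :=
    hu.continuousOn_fderivWithin hud (by norm_num)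
  have hu2 : ∀ x ∈ Metric.ball (0 : E₃) R, ContDiffAt ℝ 2 u x := fun x hx =>
    hu.contDiffAt (Filter.mem_of_superset (Metric.isOpen_ball.mem_nhds hx)
      Metric.ball_subset_closedBall)
  have hGe : ∀ x ∈ Metric.ball (0 : E₃) R, G =ᶠ[nhds x] fderiv ℝ u := by
    intro x hx
    filter_upwards [Metric.isOpen_ball.mem_nhds hx] with y hy
    exact fderivWithin_of_mem_nhds (Filter.mem_of_superset (Metric.isOpen_ball.mem_nhds hy)
      Metric.ball_subset_closedBall)
  have hG1 : ∀ x ∈ Metric.ball (0 : E₃) R, ContDiffAt ℝ 1 G x := fun x hx =>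
    ((hu2 x hx).fderiv_right (m := 1) (by norm_num)).congr_of_eventuallyEq (hGe x hx)
  obtain ⟨m, hm, hmu⟩ : ∃ m, 0 < m ∧ ∀ x ∈ Metric.closedBall (0 : E₃) (R / 2), m ≤ u x ^ p := by
    have hsub : Metric.closedBall (0 : E₃) (R / 2) ⊆ Metric.ball 0 R :=
      Metric.closedBall_subset_ball (half_lt_self hR)
    obtain ⟨y, hy, hmin⟩ := (isCompact_closedBall (0 : E₃) (R / 2)).exists_isMinOn
      (Metric.nonempty_closedBall.2 (half_pos hR).le)
      (hu.continuousOn.mono (hsub.trans Metric.ball_subset_closedBall))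
    exact ⟨u y ^ p, rpow_pos_of_pos (hpos y (hsub hy)) p, fun x hx =>
      rpow_le_rpow (hpos y (hsub hy)).le (hmin hx) (by linarith)⟩
  set a := volume.real (Metric.closedBall (0 : E₃) (R / 2))
  set b := volume.real (Metric.closedBall (0 : E₃) R)
  have ha : 0 < a := ENNReal.toReal_pos
    (Metric.measure_closedBall_pos volume _ (half_pos hR)).ne' measure_closedBall_lt_top.ne
  have hb : 0 < b := ENNReal.toReal_pos
    (Metric.measure_closedBall_pos volume _ hR).ne' measure_closedBall_lt_top.ne
  obtain ⟨ε, hε, hεab⟩ : ∃ ε, 0 < ε ∧ 3 * ε ^ 2 / R ^ 2 * b < 4 * π * ε * m * a := by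
    refine ⟨2 * π * m * a * R ^ 2 / (3 * b), by positivity, ?_⟩
    have : 0 < π ^ 2 * m ^ 2 * a ^ 2 * R ^ 2 / b := by positivity
    field_simp at this ⊢
    norm_num
  have hflux : ContinuousOn (fun x => ∑ i, x i * pohozaevField p ε R u G i x)
      (Metric.closedBall (0 : E₃) R) := by
    have := fun i => continuousOn_pohozaevField (ε := ε) (R := R) hp1 hu.continuousOn hGc i
    fun_prop
  obtain ⟨r, hr, hrR, hrpos⟩ := exists_radius_forall_pos hR hflux fun x hx =>
    sum_mul_pohozaevField_pos hp1 hε hR hx (hbd x (mem_sphere_zero_iff_norm.2 hx)) fun v hv =>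
      fderivWithin_tangent_eq_zero
        ((hu.differentiableOn (by norm_num)) x (mem_closedBall_zero_iff.2 hx.le)).hasFDerivWithinAt
        hbd hx hR hv
  obtain ⟨φ, c, hφ, hφ0, hφ1, hφr, hφs, hc0, hcr, hφc⟩ :=
    exists_radial_cutoff (a := r) (b := (r + R) / 2) (by linarith) (by linarith)
  have hφout : ∀ x, x ∉ Metric.ball (0 : E₃) R → φ =ᶠ[nhds x] 0 := by
    intro x hx
    refine notMem_tsupport_iff_eventuallyEq.1 fun h => hx ?_
    exact Metric.closedBall_subset_ball (by linarith) (hφs h)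
  let F : Fin 3 → E₃ → ℝ := fun i x => φ x * pohozaevField p ε R u G i x
  have hFout : ∀ i x, x ∉ Metric.ball (0 : E₃) R → F i =ᶠ[nhds x] fun _ => 0 := by
    intro i x hx
    filter_upwards [hφout x hx] with y hy
    simp [F, hy]
  have hF : ∀ i, ContDiff ℝ 1 (F i) := by
    intro i
    refine contDiff_iff_contDiffAt.2 fun x => ?_
    by_cases hx : x ∈ Metric.ball (0 : E₃) R
    · exact hφ.contDiffAt.mul (contDiffAt_pohozaevField ((hu2 x hx).of_le (by norm_num))
        (hG1 x hx) (hpos x hx) i)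
    · exact contDiffAt_const.congr_of_eventuallyEq (hFout i x hx)
  have hFs : ∀ i, HasCompactSupport (F i) := fun i =>
    HasCompactSupport.mul_right ((isCompact_closedBall (0 : E₃) _).of_isClosed_subset
      (isClosed_tsupport _) hφs)
  have hint := fun i => integral_fderiv_apply_eq_zero (hF i) (hFs i) (𝐞 i)
  have hzero : ∫ x, ∑ i, fderiv ℝ (F i) x (𝐞 i) = 0 := by
    rw [integral_finsetSum _ fun i _ => (hint i).1]
    exact Finset.sum_eq_zero fun i _ => (hint i).2
  let h : E₃ → ℝ := fun x =>
    (Metric.closedBall (0 : E₃) R).indicator (fun _ => 3 * ε ^ 2 / R ^ 2) x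
      - (Metric.closedBall (0 : E₃) (R / 2)).indicator (fun _ => 4 * π * ε * m) x
  have hi : ∀ (s k : ℝ), Integrable ((Metric.closedBall (0 : E₃) s).indicator fun _ => k) :=
    fun s k => (integrable_indicator_iff measurableSet_closedBall).2
      (integrableOn_const measure_closedBall_lt_top.ne)
  have hle : ∀ x, ∑ i, fderiv ℝ (F i) x (𝐞 i) ≤ h x := by
    intro x
    by_cases hx : x ∈ Metric.ball (0 : E₃) R
    · have hxR : ‖x‖ < R := mem_ball_zero_iff.1 hx
      have hsym := (hu2 x hx).isSymmSndFDerivAt (by simp)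
      have hlap : ∑ i, fderiv ℝ (fderiv ℝ u) x (𝐞 i) (𝐞 i) = -(4 * π * u x ^ p) := by
        have := heq x hx
        simp only [lap, iteratedFDeriv_two_apply] at this
        simp only [Matrix.cons_val_zero, Matrix.cons_val_one] at this
        linarith
      have hGD : HasFDerivAt G (fderiv ℝ (fderiv ℝ u) x) x := by
        rw [← (hGe x hx).fderiv_eq]
        exact ((hG1 x hx).differentiableAt one_ne_zero).hasFDerivAt
      have hGu : HasFDerivAt u (G x) x := by
        rw [(hGe x hx).eq_of_nhds]
        exact ((hu2 x hx).differentiableAt (by norm_num)).hasFDerivAt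
      rw [sum_fderiv_mul_pohozaevField hp1 hGu hGD (fun v w => hsym v w) (hpos x hx) hlap (hφc x)]
      have hcf : 0 ≤ c x * ∑ i, x i * pohozaevField p ε R u G i x := by
        rcases lt_or_ge ‖x‖ r with hxr | hxr
        · simp [hcr x hxr]
        · exact mul_nonneg (hc0 x) (hrpos x hxr hxR.le).le
      have hK : 4 * π * u x ^ (p + 1) * ((5 - p) / (2 * (p + 1))) ≤ 0 :=
        mul_nonpos_of_nonneg_of_nonpos
          (mul_nonneg (by positivity) (rpow_nonneg (hpos x hx).le _))
          (div_nonpos_of_nonpos_of_nonneg (by linarith) (by linarith))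
      have hA : 0 ≤ 3 * ε ^ 2 / R ^ 2 := by positivity
      have hup : 0 ≤ 4 * π * ε * u x ^ p :=
        mul_nonneg (by positivity) (rpow_nonneg (hpos x hx).le _)
      simp only [h]
      rw [Set.indicator_of_mem (Metric.ball_subset_closedBall hx)]
      by_cases hx2 : x ∈ Metric.closedBall (0 : E₃) (R / 2)
      · rw [Set.indicator_of_mem hx2, hφr x ((mem_closedBall_zero_iff.1 hx2).trans hr.le)]
        have : 4 * π * ε * m ≤ 4 * π * ε * u x ^ p :=
          mul_le_mul_of_nonneg_left (hmu x hx2) (by positivity)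
        linarith
      · rw [Set.indicator_of_notMem hx2]
        nlinarith [hφ0 x, hφ1 x, mul_nonneg (hφ0 x) hup, mul_nonneg (hφ0 x) (neg_nonneg.2 hK),
          mul_nonneg (sub_nonneg.2 (hφ1 x)) hA]
    · have h0 : ∀ i, fderiv ℝ (F i) x = 0 := fun i => by
        rw [(hFout i x hx).fderiv_eq, fderiv_fun_const, Pi.zero_apply]
      have hx2 : x ∉ Metric.closedBall (0 : E₃) (R / 2) := fun hx2 =>
        hx (Metric.closedBall_subset_ball (half_lt_self hR) hx2)
      simp only [h0, h, Set.indicator_of_notMem hx2]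
      simpa using Set.indicator_nonneg (fun _ _ => by positivity) x
  have hmono := integral_mono (integrable_finsetSum _ fun i _ => (hint i).1)
    ((hi R _).sub (hi (R / 2) _)) hle
  rw [hzero, integral_sub' (hi R _) (hi (R / 2) _),
    integral_indicator_const _ measurableSet_closedBall,
    integral_indicator_const _ measurableSet_closedBall, smul_eq_mul, smul_eq_mul] at hmono
  linarith
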